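/- Let K be a nonempty compact subset of ℝ^m, let N be a finite nonempty index set, and for each n ∈ N let fₙ : ℝ^m → ℝ be continuous. Suppose that for every x ∈ K there is a unique index n*(x) ∈ N with fₙ*(x)(x) > fₙ(x) for all n ≠ n*(x). Then there exist real polynomial functions qₙ : ℝ^m → ℝ, n ∈ N, such that for every x ∈ K, every maximizer of n ↦ qₙ(x) over N equals n*(x). -/

import Mathlib

open Filter Topology

/-- Multivariate Weierstrass approximation: a continuous function on `σ → ℝ` is uniformly
approximated by polynomials on each compact set. -/
theorem MvPolynomial.exists_forall_mem_norm_eval_sub_lt {σ : Type*} {K : Set (σ → ℝ)}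
    (hK : IsCompact K) {f : (σ → ℝ) → ℝ} (hf : Continuous f) {ε : ℝ} (hε : 0 < ε) :
    ∃ p : MvPolynomial σ ℝ, ∀ x ∈ K, ‖MvPolynomial.eval x p - f x‖ < ε := by
  let φ : MvPolynomial σ ℝ →ₐ[ℝ] C(σ → ℝ, ℝ) :=
    MvPolynomial.aeval fun i => ⟨fun x => x i, continuous_apply i⟩
  have hφ (p : MvPolynomial σ ℝ) (x : σ → ℝ) : φ p x = MvPolynomial.eval x p := by
    induction p using MvPolynomial.induction_on with
    | C a => simp [φ]
    | add p q hp hq => simp [hp, hq]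
    | mul_X p i hp => simp [hp, φ]
  have hsep : φ.range.SeparatesPoints := by
    intro x y hxy
    obtain ⟨i, hi⟩ := Function.ne_iff.mp hxy
    exact ⟨_, ⟨φ (MvPolynomial.X i), ⟨_, rfl⟩, rfl⟩, by simpa [hφ] using hi⟩
  obtain ⟨g, ⟨p, rfl⟩, hp⟩ :=
    ContinuousMap.exists_mem_subalgebra_near_continuous_of_isCompact_of_separatesPoints
      hsep ⟨f, hf⟩ hK hε
  exact ⟨p, fun x hx => by simpa [hφ] using hp x hx⟩

/-- If finitely many continuous functions have a strict maximizer at every point of a compact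
set, then the strict maximizer wins by a margin that is uniform over the set. -/
theorem IsCompact.exists_uniform_gap {X N : Type*} [TopologicalSpace X] [Finite N] {K : Set X}
    (hK : IsCompact K) {f : N → X → ℝ} (hf : ∀ n, Continuous (f n))
    (hopt : ∀ x ∈ K, ∃ i, ∀ n ≠ i, f n x < f i x) :
    ∃ ε > 0, ∀ x ∈ K, ∀ i, (∀ n ≠ i, f n x < f i x) → ∀ n ≠ i, f n x + ε ≤ f i x := by
  have hpair (i n : N) : ∀ᶠ ε in 𝓝[>] (0 : ℝ),
      n ≠ i → ∀ x ∈ K, (∀ k, f k x ≤ f i x) → f n x + ε ≤ f i x := by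
    by_cases hni : n = i
    · simp [hni]
    have hcompact : IsCompact (K ∩ {x | ∀ k, f k x ≤ f i x}) := by
      refine hK.inter_right ?_
      simp only [Set.ofPred_forall]
      exact isClosed_iInter fun k => isClosed_le (hf k) (hf i)
    obtain ⟨δ, hδ, hgap⟩ := hcompact.exists_forall_le' (a := 0)
      ((hf i).sub (hf n)).continuousOn fun x ⟨hx, hmax⟩ => by
        obtain ⟨j, hj⟩ := hopt x hx
        have hij : i = j := by
          by_contra hij
          exact (hj i hij).not_ge (hmax j)
        subst hij
        exact sub_pos.mpr (hj n hni)
    filter_upwards [Ioo_mem_nhdsGT hδ] with ε hε _ x hx hmax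
    have : δ ≤ f i x - f n x := hgap x ⟨hx, hmax⟩
    linarith [hε.2]
  obtain ⟨ε, hgap, hε⟩ :=
    ((eventually_all.mpr fun i => eventually_all.mpr (hpair i)).and self_mem_nhdsWithin).exists
  refine ⟨ε, hε, fun x hx i hi n hn => hgap i n hn x hx fun k => ?_⟩
  rcases eq_or_ne k i with rfl | hk
  · exact le_rfl
  · exact (hi k hk).le

/-- Beam prediction via polynomial approximation: if each channel `x` in the nonempty
compact set `K ⊆ ℝ^m` has a unique index `n*(x)` whose continuous rate map strictly
dominates all others, then there are real polynomials `q n` such that for every `x ∈ K`,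
every maximizer of `n ↦ q n (x)` equals `n*(x)`. -/
theorem polynomial_beam_prediction
    (m : ℕ) {N : Type*} [Fintype N] [Nonempty N]
    (K : Set (Fin m → ℝ)) (hK : IsCompact K) (hKne : K.Nonempty)
    (f : N → (Fin m → ℝ) → ℝ) (hf : ∀ n, Continuous (f n))
    (hopt : ∀ x ∈ K, ∃! nstar : N, ∀ n ≠ nstar, f n x < f nstar x) :
    ∃ q : N → MvPolynomial (Fin m) ℝ,
      ∀ x ∈ K, ∀ nstar : N, (∀ n ≠ nstar, f n x < f nstar x) →
        ∀ m' : N, (∀ n, MvPolynomial.eval x (q n) ≤ MvPolynomial.eval x (q m')) →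
          m' = nstar := by
  obtain ⟨ε, hε, hgap⟩ := hK.exists_uniform_gap hf fun x hx => (hopt x hx).exists
  choose q hq using fun n =>
    MvPolynomial.exists_forall_mem_norm_eval_sub_lt hK (hf n) (half_pos hε)
  refine ⟨q, fun x hx i hi j hj => ?_⟩
  by_contra hji
  have hqi := abs_lt.mp (hq i x hx)
  have hqj := abs_lt.mp (hq j x hx)
  linarith [hgap x hx i hi j hji, hj i, hqi.1, hqj.2]
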